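/- For every sequence λ = (λ_{IJ}), the norm of the mixed bi-parameter paraproduct form equals the X-norm of λ: ‖P_λ‖_{2→2} := sup_{f∈A, g∈B} |P_λ(f,g)| = ‖λ‖_X, as elements of [0,∞]. -/

import Mathlib

open MeasureTheory
open scoped ENNReal

noncomputable section

/-- A sequence `λ = (λ_{IJ})` indexed by pairs of dyadic intervals; a dyadic interval
`[2^{-i}k, 2^{-i}(k+1))` is encoded by the pair `(i, k) : ℤ × ℤ`. -/
abbrev ParaSeq := (ℤ × ℤ) → (ℤ × ℤ) → ℝ

/-- The dyadic interval `[2^{-i} k, 2^{-i}(k+1))` encoded by the pair `p = (i, k) : ℤ × ℤ`. -/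
def dyadic (p : ℤ × ℤ) : Set ℝ := Set.Ico ((2:ℝ) ^ (-p.1) * p.2) ((2:ℝ) ^ (-p.1) * (p.2 + 1))

/-- The length `|I| = 2^{-i}` of the dyadic interval encoded by `p = (i, k)`. -/
def dlen (p : ℤ × ℤ) : ℝ := (2:ℝ) ^ (-p.1)

/-- The average `⟨f⟩_I = |I|⁻¹ ∫_I f`. -/
def avg (f : ℝ → ℝ) (p : ℤ × ℤ) : ℝ := (dlen p)⁻¹ * ∫ x in dyadic p, f x

/-- Admissible families `(u_I)_{I ∈ D}` of `L²(ℝ)` functions: only finitely many nonzero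
members and `Σ_I ‖u_I‖₂² = 1`. -/
def Adm : Set ((ℤ × ℤ) → ℝ → ℝ) :=
  {u | (∀ p, MemLp (u p) 2 volume) ∧ {p | u p ≠ 0}.Finite ∧ (∑' p : ℤ × ℤ, ∫ x, (u p x) ^ 2) = 1}

/-- The bilinear sum `Σ_{I,J} λ_{IJ} ⟨g_J⟩_I ⟨u_I⟩_J`. -/
def pairSum (lam : ParaSeq) (u g : (ℤ × ℤ) → ℝ → ℝ) : ℝ :=
  ∑' pq : (ℤ × ℤ) × (ℤ × ℤ), lam pq.1 pq.2 * avg (g pq.2) pq.1 * avg (u pq.1) pq.2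

/-- The norm `‖λ‖_X`, as an element of `[0, ∞]`. -/
def Xnorm (lam : ParaSeq) : ℝ≥0∞ :=
  ⨆ (u : Adm) (g : Adm), ENNReal.ofReal |pairSum lam u.1 g.1|

/-- The norm `‖λ‖_{X'}`, as an element of `[0, ∞]`. -/
def Xprime (lam : ParaSeq) : ℝ≥0∞ :=
  ⨆ (u : Adm) (g : Adm),
    ENNReal.ofReal
      (∑' pq : (ℤ × ℤ) × (ℤ × ℤ), |lam pq.1 pq.2 * avg (g.1 pq.2) pq.1 * avg (u.1 pq.1) pq.2|)

/-- The `L²(ℝ)`-normalised Haar function `h_I = |I|^{-1/2}(1_{I_l} - 1_{I_r})`. -/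
def haar (p : ℤ × ℤ) : ℝ → ℝ := fun x =>
  (Real.sqrt (dlen p))⁻¹ *
    ((dyadic (p.1 + 1, 2 * p.2)).indicator 1 x - (dyadic (p.1 + 1, 2 * p.2 + 1)).indicator 1 x)

/-- The set `A ⊆ L²(ℝ²)`: norm-one functions `f = Σ_{I,J} f_{IJ} h_I ⊗ h_J` with `f_{IJ} ≠ 0`
for only finitely many `I`; equivalently (grouping rows `c_I = Σ_J f_{IJ} h_J`, the closed
span of the Haar system being all of `L²(ℝ)`), `f = Σ_I h_I ⊗ c_I` with finitely many
nonzero `c_I ∈ L²(ℝ)`. -/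
def PA : Set (ℝ × ℝ → ℝ) :=
  {f | MemLp f 2 volume ∧ (∫ z : ℝ × ℝ, (f z) ^ 2) = 1 ∧
    ∃ c : (ℤ × ℤ) → ℝ → ℝ, {p | c p ≠ 0}.Finite ∧ (∀ p, MemLp (c p) 2 volume) ∧
      ∀ z : ℝ × ℝ, f z = ∑' p : ℤ × ℤ, haar p z.1 * c p z.2}

/-- The set `B ⊆ L²(ℝ²)`: as `A` but with the roles of the two variables interchanged. -/
def PB : Set (ℝ × ℝ → ℝ) :=
  {g | MemLp g 2 volume ∧ (∫ z : ℝ × ℝ, (g z) ^ 2) = 1 ∧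
    ∃ c : (ℤ × ℤ) → ℝ → ℝ, {q | c q ≠ 0}.Finite ∧ (∀ q, MemLp (c q) 2 volume) ∧
      ∀ z : ℝ × ℝ, g z = ∑' q : ℤ × ℤ, c q z.1 * haar q z.2}

/-- `⟨f, h_I ⊗ 1_J/|J|⟩`. -/
def innerP (f : ℝ × ℝ → ℝ) (p q : ℤ × ℤ) : ℝ :=
  ∫ z : ℝ × ℝ, f z * haar p z.1 * ((dyadic q).indicator 1 z.2 / dlen q)

/-- `⟨g, 1_I/|I| ⊗ h_J⟩`. -/
def innerQ (g : ℝ × ℝ → ℝ) (p q : ℤ × ℤ) : ℝ :=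
  ∫ z : ℝ × ℝ, g z * ((dyadic p).indicator 1 z.1 / dlen p) * haar q z.2

/-- The bilinear form `P_λ(f,g) = Σ_{I,J} λ_{IJ} ⟨f, h_I ⊗ 1_J/|J|⟩ ⟨g, 1_I/|I| ⊗ h_J⟩`. -/
def Pform (lam : ParaSeq) (f g : ℝ × ℝ → ℝ) : ℝ :=
  ∑' pq : (ℤ × ℤ) × (ℤ × ℤ), lam pq.1 pq.2 * innerP f pq.1 pq.2 * innerQ g pq.1 pq.2

theorem mem_dyadic_iff (p : ℤ × ℤ) (x : ℝ) : x ∈ dyadic p ↔ ⌊(2:ℝ) ^ p.1 * x⌋ = p.2 := by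
  have h : (0:ℝ) < 2 ^ p.1 := by positivity
  rw [dyadic, Set.mem_Ico, Int.floor_eq_iff, zpow_neg, inv_mul_le_iff₀ h, lt_inv_mul_iff₀ h]

theorem measurableSet_dyadic (p : ℤ × ℤ) : MeasurableSet (dyadic p) := measurableSet_Ico

theorem dlen_pos (p : ℤ × ℤ) : 0 < dlen p := by
  unfold dlen
  positivity

theorem volume_dyadic (p : ℤ × ℤ) : volume (dyadic p) = ENNReal.ofReal (dlen p) := by
  rw [dyadic, Real.volume_Ico, dlen]
  ring_nf

theorem memLp_indicator_dyadic (p : ℤ × ℤ) :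
    MemLp ((dyadic p).indicator (1 : ℝ → ℝ)) 2 volume :=
  memLp_indicator_const 2 (measurableSet_dyadic p) 1 (Or.inr (by simp [volume_dyadic]))

theorem integrable_indicator_dyadic (p : ℤ × ℤ) :
    Integrable ((dyadic p).indicator (1 : ℝ → ℝ)) :=
  (integrable_indicator_iff (measurableSet_dyadic p)).2
    (integrableOn_const (by simp [volume_dyadic]))

theorem integral_indicator_dyadic (p : ℤ × ℤ) :
    ∫ x, (dyadic p).indicator (1 : ℝ → ℝ) x = dlen p := by
  rw [integral_indicator_one (measurableSet_dyadic p), measureReal_def, volume_dyadic,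
    ENNReal.toReal_ofReal (dlen_pos p).le]

theorem memLp_haar (p : ℤ × ℤ) : MemLp (haar p) 2 volume :=
  ((memLp_indicator_dyadic _).sub (memLp_indicator_dyadic _)).const_mul _

theorem integral_haar (p : ℤ × ℤ) : ∫ x, haar p x = 0 := by
  unfold haar
  rw [integral_const_mul, integral_sub (integrable_indicator_dyadic _)
    (integrable_indicator_dyadic _), integral_indicator_dyadic, integral_indicator_dyadic]
  simp [dlen]

theorem floor_two_zpow_of_le {i j : ℤ} (h : i ≤ j) (x : ℝ) :
    ⌊(2:ℝ) ^ i * x⌋ = ⌊(2:ℝ) ^ j * x⌋ / (2 ^ (j - i).toNat : ℕ) := by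
  rw [← Int.floor_div_natCast]
  congr 1
  have hz : (((2 ^ (j - i).toNat : ℕ)) : ℝ) = 2 ^ (j - i) := by
    push_cast
    rw [← zpow_natCast, Int.toNat_of_nonneg (by omega)]
  rw [hz, zpow_sub₀ (by norm_num)]
  field_simp

theorem indicator_dyadic_eq_floor (p : ℤ × ℤ) (x : ℝ) :
    (dyadic p).indicator (1 : ℝ → ℝ) x = if ⌊(2:ℝ) ^ p.1 * x⌋ = p.2 then 1 else 0 := by
  classical
  simp [Set.indicator_apply, mem_dyadic_iff]

theorem haar_eq_floor (p : ℤ × ℤ) (x : ℝ) :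
    haar p x = (Real.sqrt (dlen p))⁻¹ *
      ((if ⌊(2:ℝ) ^ (p.1 + 1) * x⌋ = 2 * p.2 then 1 else 0) -
        (if ⌊(2:ℝ) ^ (p.1 + 1) * x⌋ = 2 * p.2 + 1 then 1 else 0)) := by
  rw [haar, indicator_dyadic_eq_floor, indicator_dyadic_eq_floor]

theorem haar_eq_zero_of_notMem {p : ℤ × ℤ} {x : ℝ} (hx : x ∉ dyadic p) : haar p x = 0 := by
  rw [mem_dyadic_iff, floor_two_zpow_of_le (show p.1 ≤ p.1 + 1 by omega)] at hx
  have e : (p.1 + 1 - p.1).toNat = 1 := by omega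
  rw [e] at hx
  rw [haar_eq_floor, if_neg (by omega), if_neg (by omega)]
  simp

theorem haar_eq_of_mem_dyadic {p q : ℤ × ℤ} (h : p.1 < q.1) {x y : ℝ}
    (hx : x ∈ dyadic q) (hy : y ∈ dyadic q) : haar p x = haar p y := by
  rw [mem_dyadic_iff] at hx hy
  rw [haar_eq_floor, haar_eq_floor, floor_two_zpow_of_le (show p.1 + 1 ≤ q.1 by omega) x,
    floor_two_zpow_of_le (show p.1 + 1 ≤ q.1 by omega) y, hx, hy]

theorem integral_haar_mul_haar_of_lt {p q : ℤ × ℤ} (h : p.1 < q.1) :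
    ∫ x, haar p x * haar q x = 0 := by
  have hmem : (2:ℝ) ^ (-q.1) * q.2 ∈ dyadic q := by
    rw [dyadic, Set.left_mem_Ico]
    gcongr
    linarith
  have hconst : ∀ x, haar p x * haar q x = haar p ((2:ℝ) ^ (-q.1) * q.2) * haar q x := by
    intro x
    by_cases hx : x ∈ dyadic q
    · rw [haar_eq_of_mem_dyadic h hx hmem]
    · simp [haar_eq_zero_of_notMem hx]
  simp_rw [hconst]
  rw [integral_const_mul, integral_haar, mul_zero]

theorem integral_haar_mul_self (p : ℤ × ℤ) : ∫ x, haar p x * haar p x = 1 := by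
  have hsq : ∀ x, haar p x * haar p x = (dlen p)⁻¹ *
      ((dyadic (p.1 + 1, 2 * p.2)).indicator 1 x +
        (dyadic (p.1 + 1, 2 * p.2 + 1)).indicator 1 x) := by
    intro x
    have hs : (Real.sqrt (dlen p))⁻¹ * (Real.sqrt (dlen p))⁻¹ = (dlen p)⁻¹ := by
      rw [← mul_inv, Real.mul_self_sqrt (dlen_pos p).le]
    rw [haar, mul_mul_mul_comm, hs]
    congr 1
    simp only [indicator_dyadic_eq_floor]
    split_ifs <;> first | omega | norm_num
  simp_rw [hsq]
  rw [integral_const_mul, integral_add (integrable_indicator_dyadic _)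
    (integrable_indicator_dyadic _), integral_indicator_dyadic, integral_indicator_dyadic]
  have h : (2:ℝ) ^ (-p.1) ≠ 0 := by positivity
  simp only [dlen, neg_add, zpow_add₀ (two_ne_zero' ℝ)]
  field_simp
  norm_num

theorem integral_haar_mul_haar (p q : ℤ × ℤ) :
    ∫ x, haar p x * haar q x = if p = q then 1 else 0 := by
  split_ifs with hpq
  · rw [hpq, integral_haar_mul_self]
  rcases lt_trichotomy p.1 q.1 with h | h | h
  · exact integral_haar_mul_haar_of_lt h
  · have hz : ∀ x, haar p x * haar q x = 0 := by
      intro x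
      by_cases hx : x ∈ dyadic p
      · have hq : x ∉ dyadic q := by
          rw [mem_dyadic_iff] at hx ⊢
          rw [← h, hx]
          exact fun h' => hpq (Prod.ext h h')
        rw [haar_eq_zero_of_notMem hq, mul_zero]
      · rw [haar_eq_zero_of_notMem hx, zero_mul]
    simp [hz]
  · simp_rw [mul_comm (haar p _)]
    exact integral_haar_mul_haar_of_lt h

theorem memLp_two_mul_prod {f g : ℝ → ℝ} (hf : MemLp f 2 volume) (hg : MemLp g 2 volume) :
    MemLp (fun z : ℝ × ℝ => f z.1 * g z.2) 2 volume := by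
  have hm : AEStronglyMeasurable (fun z : ℝ × ℝ => f z.1 * g z.2) volume :=
    hf.1.comp_fst.mul hg.1.comp_snd
  rw [memLp_two_iff_integrable_sq hm]
  simp_rw [mul_pow]
  exact hf.integrable_sq.mul_prod hg.integrable_sq

/-- The function `Σ_I h_I ⊗ c_I` on the plane. -/
def haarSum (c : (ℤ × ℤ) → ℝ → ℝ) : ℝ × ℝ → ℝ := fun z => ∑' p, haar p z.1 * c p z.2

section HaarSum

variable {c : (ℤ × ℤ) → ℝ → ℝ}

theorem haarSum_eq_sum (hc : {p | c p ≠ 0}.Finite) (z : ℝ × ℝ) :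
    haarSum c z = ∑ p ∈ hc.toFinset, haar p z.1 * c p z.2 := by
  refine tsum_eq_sum fun p hp => ?_
  have : c p = 0 := by simpa using hp
  simp [this]

theorem memLp_haarSum (hc : {p | c p ≠ 0}.Finite) (hL : ∀ p, MemLp (c p) 2 volume) :
    MemLp (haarSum c) 2 volume := by
  rw [funext (haarSum_eq_sum hc)]
  exact memLp_finsetSum _ fun p _ => memLp_two_mul_prod (memLp_haar p) (hL p)

theorem integral_haarSum_mul_haar (hc : {p | c p ≠ 0}.Finite) (hL : ∀ p, MemLp (c p) 2 volume)
    {g : ℝ → ℝ} (hg : MemLp g 2 volume) (q : ℤ × ℤ) :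
    ∫ z : ℝ × ℝ, haarSum c z * (haar q z.1 * g z.2) = ∫ y, c q y * g y := by
  simp_rw [haarSum_eq_sum hc, Finset.sum_mul]
  have hInt : ∀ p ∈ hc.toFinset,
      Integrable fun z : ℝ × ℝ => haar p z.1 * c p z.2 * (haar q z.1 * g z.2) := fun p _ =>
    (memLp_two_mul_prod (memLp_haar p) (hL p)).integrable_mul
      (memLp_two_mul_prod (memLp_haar q) hg)
  rw [integral_finsetSum _ hInt]
  have hterm : ∀ p, ∫ z : ℝ × ℝ, haar p z.1 * c p z.2 * (haar q z.1 * g z.2) =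
      if p = q then ∫ y, c p y * g y else 0 := by
    intro p
    have hcomm : ∀ z : ℝ × ℝ, haar p z.1 * c p z.2 * (haar q z.1 * g z.2) =
        haar p z.1 * haar q z.1 * (c p z.2 * g z.2) := fun z => mul_mul_mul_comm _ _ _ _
    simp_rw [hcomm]
    rw [Measure.volume_eq_prod,
      integral_prod_mul (fun x => haar p x * haar q x) (fun y => c p y * g y),
      integral_haar_mul_haar]
    simp
  simp_rw [hterm]
  rw [Finset.sum_ite_eq']
  split_ifs with hq
  · rfl
  · have : c q = 0 := by simpa using hq
    simp [this]

theorem integral_haarSum_sq (hc : {p | c p ≠ 0}.Finite) (hL : ∀ p, MemLp (c p) 2 volume) :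
    ∫ z, (haarSum c z) ^ 2 = ∑' p, ∫ y, (c p y) ^ 2 := by
  rw [tsum_eq_sum (s := hc.toFinset) fun p hp => by
    have : c p = 0 := by simpa using hp
    simp [this]]
  have hexp : ∀ z, haarSum c z ^ 2 =
      ∑ p ∈ hc.toFinset, haarSum c z * (haar p z.1 * c p z.2) := by
    intro z
    rw [← Finset.mul_sum, ← haarSum_eq_sum hc, sq]
  have hInt : ∀ p ∈ hc.toFinset,
      Integrable fun z : ℝ × ℝ => haarSum c z * (haar p z.1 * c p z.2) := fun p _ =>
    (memLp_haarSum hc hL).integrable_mul (memLp_two_mul_prod (memLp_haar p) (hL p))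
  simp_rw [hexp]
  rw [integral_finsetSum _ hInt]
  exact Finset.sum_congr rfl fun p _ => by
    rw [integral_haarSum_mul_haar hc hL (hL p)]
    simp_rw [sq]

theorem innerP_haarSum (hc : {p | c p ≠ 0}.Finite) (hL : ∀ p, MemLp (c p) 2 volume)
    (p q : ℤ × ℤ) : innerP (haarSum c) p q = avg (c p) q := by
  have hg : MemLp (fun y => (dyadic q).indicator (1 : ℝ → ℝ) y / dlen q) 2 volume := by
    simp_rw [div_eq_mul_inv]
    exact (memLp_indicator_dyadic q).mul_const _
  simp only [innerP, mul_assoc]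
  rw [integral_haarSum_mul_haar hc hL hg, avg, ← integral_indicator (measurableSet_dyadic q),
    ← integral_const_mul]
  congr 1 with y
  by_cases hy : y ∈ dyadic q <;> simp [hy, div_eq_mul_inv, mul_comm]

end HaarSum

theorem innerQ_comp_swap (f : ℝ × ℝ → ℝ) (p q : ℤ × ℤ) :
    innerQ (f ∘ Prod.swap) p q = innerP f q p := by
  unfold innerQ innerP
  rw [Measure.volume_eq_prod, ← integral_prod_swap]
  congr 1 with z
  simp only [Function.comp_apply, Prod.swap_swap, Prod.fst_swap, Prod.snd_swap]
  ring

theorem haarSum_mem_PA {u : (ℤ × ℤ) → ℝ → ℝ} (hu : u ∈ Adm) : haarSum u ∈ PA :=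
  ⟨memLp_haarSum hu.2.1 hu.1, (integral_haarSum_sq hu.2.1 hu.1).trans hu.2.2,
    u, hu.2.1, hu.1, fun _ => rfl⟩

theorem exists_eq_haarSum_of_mem_PA {f : ℝ × ℝ → ℝ} (hf : f ∈ PA) :
    ∃ u ∈ Adm, f = haarSum u := by
  obtain ⟨-, h1, c, hc, hL, hfc⟩ := hf
  obtain rfl : f = haarSum c := funext hfc
  exact ⟨c, ⟨hL, hc, (integral_haarSum_sq hc hL).symm.trans h1⟩, rfl⟩

theorem comp_swap_mem_PB_iff {f : ℝ × ℝ → ℝ} : f ∘ Prod.swap ∈ PB ↔ f ∈ PA := by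
  have hms : MeasurePreserving (Prod.swap : ℝ × ℝ → ℝ × ℝ) volume volume :=
    Measure.measurePreserving_swap
  have hLp : MemLp (f ∘ Prod.swap) 2 volume ↔ MemLp f 2 volume :=
    ⟨fun h => by simpa [Function.comp_assoc] using h.comp_measurePreserving hms,
      fun h => h.comp_measurePreserving hms⟩
  have hInt : ∫ z : ℝ × ℝ, ((f ∘ Prod.swap) z) ^ 2 = ∫ z, (f z) ^ 2 := by
    rw [Measure.volume_eq_prod]
    exact integral_prod_swap fun z => f z ^ 2
  simp only [PA, PB, Set.mem_ofPred_eq, hLp, hInt]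
  refine and_congr_right fun _ => and_congr_right fun _ => exists_congr fun c =>
    and_congr_right fun _ => and_congr_right fun _ => ?_
  rw [Prod.swap_surjective.forall]
  simp [mul_comm]

theorem Pform_haarSum (lam : ParaSeq) {u g : (ℤ × ℤ) → ℝ → ℝ} (hu : u ∈ Adm) (hg : g ∈ Adm) :
    Pform lam (haarSum u) (haarSum g ∘ Prod.swap) = pairSum lam u g := by
  unfold Pform pairSum
  congr 1 with pq
  rw [innerQ_comp_swap, innerP_haarSum hu.2.1 hu.1, innerP_haarSum hg.2.1 hg.1]
  ring

/-- `‖P_λ‖_{2→2} = sup_{f ∈ A, g ∈ B} |P_λ(f,g)|`, as an element of `[0, ∞]`. -/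
def Pnorm (lam : ParaSeq) : ℝ≥0∞ :=
  ⨆ (f : PA) (g : PB), ENNReal.ofReal |Pform lam f.1 g.1|

/-- `‖P_λ‖_{2→2} = sup_{f ∈ A, g ∈ B} |P_λ(f,g)| = ‖λ‖_X` as elements of
`[0,∞]`. -/
theorem Pnorm_eq_Xnorm (lam : ParaSeq) : Pnorm lam = Xnorm lam := by
  refine le_antisymm (iSup₂_le ?_) (iSup₂_le ?_)
  · rintro ⟨f, hf⟩ ⟨g, hg⟩
    obtain ⟨u, hu, rfl⟩ := exists_eq_haarSum_of_mem_PA hf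
    obtain ⟨f', rfl⟩ : ∃ f', g = f' ∘ Prod.swap := ⟨g ∘ Prod.swap, by simp [Function.comp_assoc]⟩
    obtain ⟨v, hv, rfl⟩ := exists_eq_haarSum_of_mem_PA (comp_swap_mem_PB_iff.1 hg)
    rw [Pform_haarSum lam hu hv]
    exact le_iSup₂_of_le (⟨u, hu⟩ : Adm) (⟨v, hv⟩ : Adm) le_rfl
  · rintro ⟨u, hu⟩ ⟨v, hv⟩
    rw [← Pform_haarSum lam hu hv]
    exact le_iSup₂_of_le (⟨_, haarSum_mem_PA hu⟩ : PA)
      (⟨_, comp_swap_mem_PB_iff.2 (haarSum_mem_PA hv)⟩ : PB) le_rfl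

end
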